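/- In R = ℂ[x,y,z,w], let ℓ be a nonzero linear form and q a quadratic form with q ∉ (ℓ) (so that ℓ, q is a regular sequence and (ℓ,q) is the ideal of a conic in P³), and let a, b ∈ R be homogeneous of degrees 4 and 3 respectively, having no common zero on the set {p ∈ ℂ⁴ ∖ {0} : ℓ(p) = q(p) = 0}. Let I = (a·ℓ + b·q, ℓ², ℓ·q, q²). Then every homogeneous element of I of degree at most 4 belongs to the ideal (ℓ², ℓ·q, q²), while a·ℓ + b·q does not belong to (ℓ², ℓ·q, q²); in particular, I is strictly larger than the ideal generated by its homogeneous elements of degree at most 4. (This expresses that the twisted ideal sheaf I_Z(2) of the double conic Z is not globally generated.) -/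

import Mathlib

open MvPolynomial

namespace MvPolynomial

section CommSemiring

variable {σ R : Type*} [CommSemiring R]

theorem IsHomogeneous.eval_smul {φ : MvPolynomial σ R} {n : ℕ} (hφ : φ.IsHomogeneous n)
    (c : R) (p : σ → R) : eval (c • p) φ = c ^ n * eval p φ := by
  rw [eval_eq, eval_eq, Finset.mul_sum]
  refine Finset.sum_congr rfl fun d hd => ?_
  have hd' : ∑ i ∈ d.support, d i = n := (hφ.degree_eq_sum_deg_support hd).symm
  simp only [Pi.smul_apply, smul_eq_mul, mul_pow, Finset.prod_mul_distrib,
    Finset.prod_pow_eq_pow_sum, hd']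
  ring

/-- Evaluation of a linear form is a linear map. -/
theorem IsHomogeneous.exists_linearMap_eq_eval {l : MvPolynomial σ R} (hl : l.IsHomogeneous 1) :
    ∃ f : (σ → R) →ₗ[R] R, ∀ p, f p = eval p l := by
  have hmem : l ∈ Submodule.span R (Set.range (X : σ → MvPolynomial σ R)) := by
    rwa [← homogeneousSubmodule_one_eq_span_X, mem_homogeneousSubmodule]
  clear hl
  induction hmem using Submodule.span_induction with
  | mem x hx =>
    obtain ⟨i, rfl⟩ := hx
    exact ⟨LinearMap.proj i, by simp⟩
  | zero => exact ⟨0, by simp⟩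
  | add x y _ _ hx hy =>
    obtain ⟨f, hf⟩ := hx
    obtain ⟨g, hg⟩ := hy
    exact ⟨f + g, by simp [hf, hg]⟩
  | smul c x _ hx =>
    obtain ⟨f, hf⟩ := hx
    exact ⟨c • f, by simp [hf]⟩

attribute [local instance] MvPolynomial.gradedAlgebra

/-- An ideal generated by homogeneous elements contains the components of its elements. -/
theorem homogeneousComponent_mem_span {s : Set (MvPolynomial σ R)}
    (hs : ∀ f ∈ s, ∃ n, f.IsHomogeneous n) {f : MvPolynomial σ R} (hf : f ∈ Ideal.span s) (n : ℕ) :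
    homogeneousComponent n f ∈ Ideal.span s :=
  homogeneousComponent_mem_of_mem (Ideal.homogeneous_span _ s hs) hf n

theorem homogeneousComponent_mul_eq_zero_of_lt {φ ψ : MvPolynomial σ R} {m n : ℕ}
    (hψ : ψ.IsHomogeneous m) (hn : n < m) : homogeneousComponent n (φ * ψ) = 0 := by
  rw [← decomposition.decompose'_apply]
  exact DirectSum.coe_decompose_mul_of_right_mem_of_not_le (homogeneousSubmodule σ R)
    ((mem_homogeneousSubmodule m ψ).2 hψ) hn.not_ge

end CommSemiring

section Field

variable {σ K : Type*} [Field K]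

theorem IsHomogeneous.prime_of_one {l : MvPolynomial σ K} (hl : l.IsHomogeneous 1) (hl0 : l ≠ 0) :
    Prime l := by
  refine (irreducible_of_totalDegree_eq_one (hl.totalDegree hl0) fun x hx => ?_).prime
  obtain ⟨d, hd⟩ := ne_zero_iff.1 hl0
  exact (ne_zero_of_dvd_ne_zero hd (hx d)).isUnit

variable [IsAlgClosed K]

/-- A polynomial takes the value zero on a line, or is constant along it. -/
theorem exists_eval_add_smul_eq_zero_or_const (q : MvPolynomial σ K) (u v : σ → K) :
    (∃ s : K, eval (u + s • v) q = 0) ∨ ∃ c : K, ∀ s : K, eval (u + s • v) q = c := by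
  let P : Polynomial K := aeval (fun i => Polynomial.C (u i) + Polynomial.X * Polynomial.C (v i)) q
  have hP : ∀ s, P.eval s = eval (u + s • v) q := by
    intro s
    rw [← Polynomial.coe_evalRingHom, map_aeval, eval, coe_eval₂Hom, coe_eval₂Hom]
    congr 1
    · ext x
      simp
    · ext i
      simp
      ring
  by_cases hdeg : P.degree = 0
  · right
    refine ⟨P.coeff 0, fun s => ?_⟩
    rw [← hP, Polynomial.eq_C_of_degree_eq_zero hdeg]
    simp
  · left
    obtain ⟨s, hs⟩ := IsAlgClosed.exists_root P hdeg
    exact ⟨s, (hP s).symm.trans hs⟩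

/-- A form of positive degree vanishes at a nonzero point of the span of two independent vectors. -/
theorem IsHomogeneous.exists_eval_eq_zero_of_linearIndependent {q : MvPolynomial σ K} {n : ℕ}
    (hq : q.IsHomogeneous n) (hn : n ≠ 0) {u v : σ → K} (h : LinearIndependent K ![u, v]) :
    ∃ s t : K, s • u + t • v ≠ 0 ∧ eval (s • u + t • v) q = 0 := by
  rw [LinearIndependent.pair_iff] at h
  rcases exists_eval_add_smul_eq_zero_or_const q u v with ⟨s, hs⟩ | ⟨c, hc⟩
  · exact ⟨1, s, fun h0 => one_ne_zero (h _ _ h0).1, by rwa [one_smul]⟩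
  rcases exists_eval_add_smul_eq_zero_or_const q v u with ⟨s, hs⟩ | ⟨d, hd⟩
  · exact ⟨s, 1, fun h0 => one_ne_zero (h _ _ h0).2, by rwa [one_smul, add_comm]⟩
  refine ⟨1, 0, fun h0 => one_ne_zero (h _ _ h0).1, ?_⟩
  have key : ∀ s : K, s ≠ 0 → c = s ^ n * d := by
    intro s hs
    rw [← hc s, ← hd s⁻¹, ← hq.eval_smul, smul_add, smul_smul, mul_inv_cancel₀ hs, one_smul,
      add_comm]
  have hc0 : c = 0 := by
    by_contra hc0
    have hd0 : d = c := by simpa using (key 1 one_ne_zero).symm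
    have hpow : ∀ s : K, s ≠ 0 → s ^ n = 1 := fun s hs =>
      mul_right_cancel₀ hc0 (by rw [one_mul, ← hd0, ← key s hs, hd0])
    classical
    have hfin : (Set.univ : Set K).Finite := by
      refine ((Polynomial.nthRoots n (1 : K)).toFinset.finite_toSet.union
        (Set.finite_singleton 0)).subset fun s _ => ?_
      by_cases hs : s = 0
      · exact Or.inr hs
      · exact Or.inl (by simp [Polynomial.mem_nthRoots (Nat.pos_of_ne_zero hn), hpow s hs])
    have : Infinite K := IsAlgClosed.instInfinite
    exact Set.infinite_univ hfin
  simpa [hc0] using hc 0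

/-- A linear form and a form of positive degree in at least three variables have a common
nontrivial zero. -/
theorem IsHomogeneous.exists_common_zero [Fintype σ] (hσ : 2 < Fintype.card σ)
    {l q : MvPolynomial σ K} {n : ℕ} (hl : l.IsHomogeneous 1) (hq : q.IsHomogeneous n)
    (hn : n ≠ 0) : ∃ p : σ → K, p ≠ 0 ∧ eval p l = 0 ∧ eval p q = 0 := by
  obtain ⟨f, hf⟩ := hl.exists_linearMap_eq_eval
  have hker : 1 < Module.finrank K (LinearMap.ker f) := by
    have h₁ := f.finrank_range_add_finrank_ker
    have h₂ := (LinearMap.range f).finrank_le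
    rw [Module.finrank_fintype_fun_eq_card] at h₁
    rw [Module.finrank_self] at h₂
    omega
  have : Nontrivial (LinearMap.ker f) := Module.nontrivial_of_finrank_pos (zero_lt_one.trans hker)
  obtain ⟨u, hu⟩ := exists_ne (0 : LinearMap.ker f)
  obtain ⟨v, huv⟩ := exists_linearIndependent_pair_of_one_lt_finrank hker hu
  have huv' : LinearIndependent K ![(u : σ → K), (v : σ → K)] := by
    rw [LinearIndependent.pair_iff] at huv ⊢
    exact fun s t hst => huv s t (Subtype.ext hst)
  obtain ⟨s, t, h0, h⟩ := hq.exists_eval_eq_zero_of_linearIndependent hn huv'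
  exact ⟨_, h0, by rw [← hf, map_add, map_smul, map_smul, u.2, v.2]; simp, h⟩

end Field

end MvPolynomial

/-- If `l` is prime and does not divide `q`, then `l` and `q` are independent modulo `(l, q)²`
over `(l, q)`. -/
theorem Prime.mem_span_pair_of_mul_add_mul_mem {A : Type*} [CommRing A] [IsDomain A] {l q a b : A}
    (hl : Prime l) (hlq : ¬ l ∣ q)
    (h : a * l + b * q ∈ Ideal.span ({l ^ 2, l * q, q ^ 2} : Set A)) :
    a ∈ Ideal.span ({l, q} : Set A) ∧ b ∈ Ideal.span ({l, q} : Set A) := by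
  obtain ⟨u, v, w, h⟩ := Submodule.mem_span_triple.1 h
  simp only [smul_eq_mul] at h
  have hdvd : l ∣ q * (w * q - b) := ⟨a - u * l - v * q, by linear_combination h⟩
  obtain ⟨t, ht⟩ : l ∣ w * q - b := (hl.dvd_or_dvd hdvd).resolve_left hlq
  refine ⟨Ideal.mem_span_pair.2 ⟨u, v + t, ?_⟩, Ideal.mem_span_pair.2 ⟨-t, w, ?_⟩⟩
  · exact mul_left_cancel₀ hl.ne_zero (by linear_combination h - q * ht)
  · linear_combination ht

/-- In `R = ℂ[x,y,z,w]`, for a conic `{ℓ = q = 0}` (with `ℓ` a nonzero linear form and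
`q` a quadratic form, `q ∉ (ℓ)`) and `a, b` homogeneous of degrees `4`, `3` with no
common zero on the conic, the ideal `I = (a·ℓ + b·q, ℓ², ℓ·q, q²)` of the double conic
is not generated in degrees `≤ 4`: its homogeneous elements of degree `≤ 4` all lie in
`(ℓ², ℓ·q, q²)`, while `a·ℓ + b·q` does not; in particular `I` is strictly larger than
the ideal generated by its homogeneous elements of degree at most `4`. -/
theorem double_conic_ideal_not_generated_by_quartics
    (l q a b : MvPolynomial (Fin 4) ℂ)
    (hl : l.IsHomogeneous 1) (hl0 : l ≠ 0)
    (hq : q.IsHomogeneous 2) (hql : q ∉ Ideal.span ({l} : Set (MvPolynomial (Fin 4) ℂ)))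
    (hah : a.IsHomogeneous 4) (hbh : b.IsHomogeneous 3)
    (hab : ∀ p : Fin 4 → ℂ, p ≠ 0 → eval p l = 0 → eval p q = 0 →
      ¬(eval p a = 0 ∧ eval p b = 0)) :
    (∀ f ∈ Ideal.span {a * l + b * q, l ^ 2, l * q, q ^ 2},
        (∃ d ≤ 4, f.IsHomogeneous d) →
        f ∈ Ideal.span ({l ^ 2, l * q, q ^ 2} : Set (MvPolynomial (Fin 4) ℂ))) ∧
    a * l + b * q ∉ Ideal.span ({l ^ 2, l * q, q ^ 2} : Set (MvPolynomial (Fin 4) ℂ)) ∧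
    Ideal.span {f | f ∈ Ideal.span {a * l + b * q, l ^ 2, l * q, q ^ 2} ∧
        ∃ d ≤ 4, f.IsHomogeneous d}
      < Ideal.span {a * l + b * q, l ^ 2, l * q, q ^ 2} := by
  have hg : (a * l + b * q).IsHomogeneous 5 := (hah.mul hl).add (hbh.mul hq)
  have hlow : ∀ f ∈ Ideal.span {a * l + b * q, l ^ 2, l * q, q ^ 2},
      (∃ d ≤ 4, f.IsHomogeneous d) →
      f ∈ Ideal.span ({l ^ 2, l * q, q ^ 2} : Set (MvPolynomial (Fin 4) ℂ)) := by
    rintro f hf ⟨d, hd, hfd⟩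
    obtain ⟨c, g, hgJ, rfl⟩ := Ideal.mem_span_insert.1 hf
    rw [← homogeneousComponent_eq_self hfd, map_add,
      homogeneousComponent_mul_eq_zero_of_lt hg (by omega), zero_add]
    refine homogeneousComponent_mem_span ?_ hgJ d
    rintro x (rfl | rfl | rfl)
    exacts [⟨_, hl.pow 2⟩, ⟨_, hl.mul hq⟩, ⟨_, hq.pow 2⟩]
  have hnot : a * l + b * q ∉
      Ideal.span ({l ^ 2, l * q, q ^ 2} : Set (MvPolynomial (Fin 4) ℂ)) := by
    intro h
    obtain ⟨ha, hb⟩ := (hl.prime_of_one hl0).mem_span_pair_of_mul_add_mul_mem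
      (fun hdvd => hql (Ideal.mem_span_singleton.2 hdvd)) h
    obtain ⟨p, hp0, hpl, hpq⟩ := hl.exists_common_zero (by simp) hq two_ne_zero
    have hvanish : ∀ f ∈ Ideal.span ({l, q} : Set (MvPolynomial (Fin 4) ℂ)), eval p f = 0 := by
      intro f hf
      obtain ⟨u, v, rfl⟩ := Ideal.mem_span_pair.1 hf
      simp [hpl, hpq]
    exact hab p hp0 hpl hpq ⟨hvanish a ha, hvanish b hb⟩
  refine ⟨hlow, hnot, lt_of_le_of_ne (Ideal.span_le.2 fun f hf => hf.1) fun heq => hnot ?_⟩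
  have hle : Ideal.span {f | f ∈ Ideal.span {a * l + b * q, l ^ 2, l * q, q ^ 2} ∧
      ∃ d ≤ 4, f.IsHomogeneous d} ≤ Ideal.span {l ^ 2, l * q, q ^ 2} :=
    Ideal.span_le.2 fun f hf => hlow f hf.1 hf.2
  exact hle (heq.ge (Ideal.subset_span (Set.mem_insert _ _)))
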